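/- If P is a Dyck prefix with at least one return point (a non-initial point of P at height 0), then f(dP) = f(P). -/

import Mathlib

/-- A binary path is a list of steps: `true` = upstep `u`, `false` = downstep `d`. -/
abbrev BinPath := List Bool

/-- `ht P k` is the height of the `k`-th point of the path `P` (the point reached
after the first `k` steps). -/
def ht (P : BinPath) (k : ℕ) : ℤ :=
  ((P.take k).map (fun b => if b then (1 : ℤ) else -1)).sum

/-- The lattice order on binary paths of the same length: `P ≤ Q` iff
`hᵢ(P) ≤ hᵢ(Q)` for all `i`. -/
def pathLe (P Q : BinPath) : Prop :=
  P.length = Q.length ∧ ∀ k, ht P k ≤ ht Q k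

def pathLt (P Q : BinPath) : Prop := pathLe P Q ∧ P ≠ Q

/-- The maximum path `1ₙ = uⁿ`. -/
def maxPath (n : ℕ) : BinPath := List.replicate n true

/-- Step `i` (0-based) of `P` is a downstep whose endpoint is a valley, i.e. it is
followed by an upstep or it is the last step of `P`. -/
def isValley (P : BinPath) (i : ℕ) : Prop :=
  i < P.length ∧ P.getD i true = false ∧ P.getD (i + 1) true = true

/-- The number of valleys of `P`. -/
def numValleys (P : BinPath) : ℕ :=
  ((Finset.range P.length).filter
    (fun i => P.getD i true = false ∧ P.getD (i + 1) true = true)).card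

/-- The filling of `P`: every valley of `P` is turned into a peak
(each occurrence `du` whose middle point is a valley becomes `ud`, and a final
valley-`d` becomes `u`). -/
def fill (P : BinPath) : BinPath :=
  List.ofFn (fun i : Fin P.length =>
    if P.get i then P.getD (i.1 - 1) true else P.getD (i.1 + 1) true)

/-- The degree of `P`: the least `k` such that the `k`-fold iterated filling
of `P` is the maximum path. -/
noncomputable def degree (P : BinPath) : ℕ :=
  sInf {k | fill^[k] P = maxPath P.length}

/-- `fPath P` is the number of chains from `P` to the maximum path `1_{|P|}` of
length `degree P` having small intervals. -/
noncomputable def fPath (P : BinPath) : ℕ :=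
  Set.ncard {c : ℕ → BinPath |
    c 0 = P ∧ (∀ i, degree P ≤ i → c i = maxPath P.length) ∧
    ∀ i < degree P, pathLt (c i) (c (i + 1)) ∧ pathLe (c (i + 1)) (fill (c i))}

/-- Height of the lowest valley of `P`. -/
noncomputable def lv (P : BinPath) : ℤ :=
  sInf {h : ℤ | ∃ i, isValley P i ∧ ht P (i + 1) = h}

/-- Height of the highest valley of `P`. -/
noncomputable def hv (P : BinPath) : ℤ :=
  sSup {h : ℤ | ∃ i, isValley P i ∧ ht P (i + 1) = h}

noncomputable def hvNat (P : BinPath) : ℕ := (hv P).toNat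

/-- `P′`: every low valley of `P` is turned into a peak. -/
noncomputable def lowFill (P : BinPath) : BinPath :=
  List.ofFn (fun i : Fin P.length =>
    if P.get i then
      (if P.getD (i.1 - 1) true = false ∧ ht P i.1 = lv P then false else true)
    else
      (if P.getD (i.1 + 1) true = true ∧ ht P (i.1 + 1) = lv P then true else false))

/-- `P*`: every valley of `P` is turned into a peak, except the last one when `P`
ends with a downstep. -/
def starFill (P : BinPath) : BinPath :=
  List.ofFn (fun i : Fin P.length =>
    if i.1 + 1 = P.length ∧ P.get i = false then false
    else if P.get i then P.getD (i.1 - 1) true else P.getD (i.1 + 1) true)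

/-- A Dyck path: starts and ends at height 0 and lies weakly above height 0. -/
def IsDyck (P : BinPath) : Prop := ht P P.length = 0 ∧ ∀ k, 0 ≤ ht P k

/-- A Dyck prefix: a prefix of a Dyck path. -/
def IsDyckPrefix (P : BinPath) : Prop := ∃ Q : BinPath, IsDyck (P ++ Q)

/-- A Dyck suffix: a suffix of a Dyck path. -/
def IsDyckSuffix (P : BinPath) : Prop := ∃ Q : BinPath, IsDyck (Q ++ P)

/-- The pyramid `u^m d^m`. -/
def pyramid (m : ℕ) : BinPath := List.replicate m true ++ List.replicate m false

/-- Cardinality of the interval `[P, Q]` in the lattice of binary paths. -/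
noncomputable def intervalCard (P Q : BinPath) : ℕ :=
  Set.ncard {R : BinPath | pathLe P R ∧ pathLe R Q}

/-- `I(s) = |[s, u^{|s|/2} d^{|s|/2}]|`. -/
noncomputable def Ifun (s : BinPath) : ℕ := intervalCard s (pyramid (s.length / 2))

/-- `J(P) = |[P, u^{|P|}]|`. -/
noncomputable def Jfun (P : BinPath) : ℕ := intervalCard P (maxPath P.length)

/-- `P` and `Q` have exactly the same valleys at every height at most `m`. -/
def sameValleysUpTo (P Q : BinPath) (m : ℤ) : Prop :=
  ∀ (i : ℕ) (t : ℤ), t ≤ m →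
    ((isValley P i ∧ ht P (i + 1) = t) ↔ (isValley Q i ∧ ht Q (i + 1) = t))

/-- A multichain of Dyck paths of type `V` from `a` to `s`: it has length
`h = hv(a)` and for every `j ∈ [h]` its `(j-1)`-st and `j`-th members have the
same valleys at every height at most `h - j`.  (The function `σ` is frozen from
index `h` on, so that such multichains are counted correctly.) -/
def IsVChain (a s : BinPath) (σ : ℕ → BinPath) : Prop :=
  σ 0 = a ∧ (∀ j, hvNat a ≤ j → σ j = s) ∧ (∀ j, IsDyck (σ j)) ∧
  (∀ j < hvNat a, pathLe (σ j) (σ (j + 1))) ∧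
  (∀ j, 1 ≤ j → j ≤ hvNat a →
    sameValleysUpTo (σ (j - 1)) (σ j) ((hvNat a : ℤ) - (j : ℤ)))

/-- `V(a,s)`: the number of `a`–`s` multichains of type `V`. -/
noncomputable def VPath (a s : BinPath) : ℕ :=
  Set.ncard {σ : ℕ → BinPath | IsVChain a s σ}

/-- `ζ^k(P,Q)`: the number of `P`–`Q` multichains of length `k`. -/
noncomputable def zetaPow (k : ℕ) (P Q : BinPath) : ℕ :=
  Set.ncard {c : ℕ → BinPath |
    c 0 = P ∧ (∀ i, k ≤ i → c i = Q) ∧ ∀ i < k, pathLe (c i) (c (i + 1))}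

/-- The join of two paths of the same length (pointwise max of heights). -/
def pathSup (P Q : BinPath) : BinPath :=
  List.ofFn (fun i : Fin P.length =>
    decide (max (ht P i.1) (ht Q i.1) < max (ht P (i.1 + 1)) (ht Q (i.1 + 1))))

/-- The meet of two paths of the same length (pointwise min of heights). -/
def pathInf (P Q : BinPath) : BinPath :=
  List.ofFn (fun i : Fin P.length =>
    decide (min (ht P i.1) (ht Q i.1) < min (ht P (i.1 + 1)) (ht Q (i.1 + 1))))

/-- `Q` covers `P` in the lattice of binary paths. -/
def pathCovBy (P Q : BinPath) : Prop :=
  pathLt P Q ∧ ∀ R : BinPath, pathLt P R → pathLt R Q → False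

/-- `l(P,Q) = (1/2)·Σᵢ (hᵢ(Q) − hᵢ(P))`. -/
def lpq (P Q : BinPath) : ℕ :=
  ((∑ i ∈ Finset.range P.length, (ht Q (i + 1) - ht P (i + 1))) / 2).toNat

/-- Convolution in the incidence algebra of the lattice of binary paths. -/
noncomputable def conv (F G : BinPath → BinPath → ℤ) : BinPath → BinPath → ℤ :=
  fun P Q => ∑ᶠ (R : BinPath) (_ : pathLe P R ∧ pathLe R Q), F P R * G R Q

/-- The delta function of the incidence algebra. -/
def deltaFun : BinPath → BinPath → ℤ := fun P Q => if P = Q then 1 else 0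

/-- `μ^k`: the `k`-th convolution power of `μ` (`μ^0` is the delta function). -/
noncomputable def muPow (mu : BinPath → BinPath → ℤ) (k : ℕ) : BinPath → BinPath → ℤ :=
  (conv mu)^[k] deltaFun

section Heights

lemma ht_zero (P : BinPath) : ht P 0 = 0 := by simp [ht]

lemma ht_succ {P : BinPath} {k : ℕ} (hk : k < P.length) :
    ht P (k + 1) = ht P k + if P.getD k true then 1 else -1 := by
  rw [ht, ht, List.take_add_one, List.getElem?_eq_getElem hk, List.getD_eq_getElem _ _ hk,
    List.map_append, List.sum_append]
  simp [-List.map_take]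

lemma ht_of_length_le {P : BinPath} {k : ℕ} (hk : P.length ≤ k) : ht P k = ht P P.length := by
  simp [ht, List.take_of_length_le hk]

lemma ht_succ_cases {P : BinPath} {k : ℕ} (hk : k < P.length) :
    ht P (k + 1) = ht P k + 1 ∨ ht P (k + 1) = ht P k - 1 := by
  rw [ht_succ hk]; split <;> omega

lemma ht_succ_le (P : BinPath) (k : ℕ) : ht P (k + 1) ≤ ht P k + 1 := by
  by_cases hk : k < P.length
  · have := ht_succ_cases hk; omega
  · rw [ht_of_length_le (P := P) (k := k) (by omega),
      ht_of_length_le (P := P) (k := k + 1) (by omega)]; omega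

lemma le_ht_succ (P : BinPath) (k : ℕ) : ht P k - 1 ≤ ht P (k + 1) := by
  by_cases hk : k < P.length
  · have := ht_succ_cases hk; omega
  · rw [ht_of_length_le (P := P) (k := k) (by omega),
      ht_of_length_le (P := P) (k := k + 1) (by omega)]; omega

lemma ht_add_le (P : BinPath) (k j : ℕ) : ht P (k + j) ≤ ht P k + j := by
  induction j with
  | zero => simp
  | succ j ih => have := ht_succ_le P (k + j); rw [← add_assoc]; push_cast; omega

lemma ht_le (P : BinPath) (k : ℕ) : ht P k ≤ k := by
  simpa [ht_zero] using ht_add_le P 0 k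

lemma ht_eq_of_le {P : BinPath} {k x : ℕ} (h : (k : ℤ) ≤ ht P k) (hx : x ≤ k) : ht P x = x := by
  have h1 := ht_add_le P x (k - x)
  rw [Nat.add_sub_cancel' hx] at h1
  have h2 := ht_le P x
  omega

lemma ht_parity {P : BinPath} {k : ℕ} (hk : k ≤ P.length) : ht P k % 2 = (k : ℤ) % 2 := by
  induction k with
  | zero => simp [ht_zero]
  | succ k ih =>
    have := ih (by omega)
    have := ht_succ_cases (P := P) (k := k) (by omega)
    push_cast; omega

lemma path_ext {P Q : BinPath} (hl : P.length = Q.length)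
    (h : ∀ k ≤ P.length, ht P k = ht Q k) : P = Q := by
  refine List.ext_getElem hl fun k hk hk' => ?_
  have h1 := ht_succ hk
  have h2 := ht_succ hk'
  rw [h k hk.le, h (k + 1) hk] at h1
  rw [h1] at h2
  simp only [List.getD_eq_getElem?_getD, List.getElem?_eq_getElem hk,
    List.getElem?_eq_getElem hk', Option.getD_some] at h2
  revert h2
  cases P[k] <;> cases Q[k] <;> simp

lemma pathLe_of_forall {P Q : BinPath} (hl : P.length = Q.length)
    (h : ∀ k ≤ P.length, ht P k ≤ ht Q k) : pathLe P Q := by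
  refine ⟨hl, fun k => ?_⟩
  by_cases hk : k ≤ P.length
  · exact h k hk
  · rw [ht_of_length_le (P := P) (k := k) (by omega),
      ht_of_length_le (P := Q) (k := k) (by omega), ← hl]
    exact h _ le_rfl

lemma ht_append (P Q : BinPath) (k : ℕ) : ht (P ++ Q) k = ht P k + ht Q (k - P.length) := by
  simp [ht, List.take_append]

lemma ht_drop (P : BinPath) (i k : ℕ) : ht (P.drop i) k = ht P (i + k) - ht P i := by
  simp [ht, List.take_add]

lemma ht_replicate (n k : ℕ) : ht (List.replicate n true) k = min k n := by
  simp [ht, List.take_replicate]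

lemma ht_cons_false (P : BinPath) (k : ℕ) : ht (false :: P) (k + 1) = ht P k - 1 := by
  simp [ht]; ring

lemma ht_maxPath {n k : ℕ} (hk : k ≤ n) : ht (maxPath n) k = k := by
  rw [maxPath, ht_replicate]; simp [hk]

lemma length_maxPath (n : ℕ) : (maxPath n).length = n := by simp [maxPath]

lemma eq_maxPath {P : BinPath} (h : (P.length : ℤ) ≤ ht P P.length) : P = maxPath P.length := by
  refine path_ext (length_maxPath _).symm fun k hk => ?_
  rw [ht_maxPath hk, ht_eq_of_le h hk]

end Heights

section Fill

lemma length_fill (P : BinPath) : (fill P).length = P.length := by simp [fill]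

lemma getD_fill {P : BinPath} {k : ℕ} (hk : k < P.length) :
    (fill P).getD k true = if P.getD k true then P.getD (k - 1) true else P.getD (k + 1) true := by
  have hk' : k < (fill P).length := by rwa [length_fill]
  rw [List.getD_eq_getElem _ _ hk', List.getD_eq_getElem _ _ hk]
  simp [fill]

lemma ht_fill_valley {P : BinPath} {k : ℕ} (hk : k ≤ P.length) :
    ht (fill P) k = ht P k +
      if 0 < k ∧ P.getD (k - 1) true = false ∧ P.getD k true = true then 2 else 0 := by
  induction k with
  | zero => simp [ht_zero]
  | succ k ih =>
    have hk' : k < P.length := hk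
    rw [ht_succ (by rwa [length_fill]), ht_succ hk', ih hk'.le, getD_fill hk']
    rcases Nat.eq_zero_or_pos k with rfl | hpos
    · cases h0 : P.getD 0 true <;> cases h1 : P.getD 1 true <;>
        simp [-List.getD_eq_getElem?_getD, h0, h1] <;> ring
    · cases h0 : P.getD (k - 1) true <;> cases h1 : P.getD k true <;>
        cases h2 : P.getD (k + 1) true <;> simp [-List.getD_eq_getElem?_getD, h0, h1, h2, hpos] <;> ring

lemma ht_fill {P : BinPath} {k : ℕ} (hk : k + 1 < P.length) :
    ht (fill P) (k + 1) = min (ht P k) (ht P (k + 2)) + 1 := by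
  rw [ht_fill_valley hk.le, ht_succ hk, ht_succ (by omega : k < P.length)]
  cases h0 : P.getD k true <;> cases h1 : P.getD (k + 1) true <;>
    simp [-List.getD_eq_getElem?_getD, h0, h1] <;> omega

lemma ht_fill_last {P : BinPath} {k : ℕ} (hk : k + 1 = P.length) :
    ht (fill P) (k + 1) = ht P k + 1 := by
  have h2 : P.getD (k + 1) true = true := by
    simp [List.getD_eq_getElem?_getD, hk]
  rw [ht_fill_valley hk.le, ht_succ (by omega : k < P.length), h2]
  cases h0 : P.getD k true <;> simp [-List.getD_eq_getElem?_getD, h0] <;> omega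

lemma ht_fill_succ_le {P : BinPath} {k : ℕ} (hk : k + 1 ≤ P.length) :
    ht (fill P) (k + 1) ≤ ht P k + 1 := by
  rcases hk.lt_or_eq with h | h
  · rw [ht_fill h]; omega
  · rw [ht_fill_last h]

lemma ht_fill_le_succ {P : BinPath} {k : ℕ} (hk : k + 1 ≤ P.length) :
    ht (fill P) k ≤ ht P (k + 1) + 1 := by
  cases k with
  | zero => have := le_ht_succ P 0; simp only [ht_zero] at *; omega
  | succ k => rw [ht_fill (by omega), show k + 1 + 1 = k + 2 from rfl]; omega

lemma length_iterate_fill (P : BinPath) (k : ℕ) : (fill^[k] P).length = P.length := by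
  induction k with
  | zero => rfl
  | succ k ih => rw [Function.iterate_succ_apply', length_fill, ih]

lemma min_le_ht_iterate_fill {P : BinPath} {y : ℤ}
    (h : ∀ x ≤ P.length, min (x : ℤ) y ≤ ht P x) (k : ℕ) :
    ∀ x ≤ P.length, min (x : ℤ) (y + k) ≤ ht (fill^[k] P) x := by
  induction k with
  | zero => simpa using h
  | succ k ih =>
    intro x hx
    rw [Function.iterate_succ_apply']
    have hl := length_iterate_fill P k
    cases x with
    | zero => simp [ht_zero]
    | succ x =>
      have h1 := ih x (by omega)
      rcases hx.lt_or_eq with hx' | hx'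
      · have h2 := ih (x + 2) (by omega)
        rw [ht_fill (by omega)]
        push_cast at *; omega
      · rw [ht_fill_last (by omega)]
        push_cast at *; omega

/-- A low point of a path can only rise by one at each step of a chain with small intervals. -/
lemma exists_ht_le {c : ℕ → BinPath} {N j : ℕ} {y : ℤ}
    (hx : ∃ x : ℕ, x ≤ N ∧ y < x ∧ ht (c j) x ≤ y) (t : ℕ)
    (hc : ∀ i, j ≤ i → i < j + t → (c i).length = N ∧ pathLe (c (i + 1)) (fill (c i)))
    (hy : y + t + 2 ≤ N) :
    ∃ x : ℕ, x ≤ N ∧ y + t < x ∧ ht (c (j + t)) x ≤ y + t := by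
  induction t with
  | zero => simpa using hx
  | succ t ih =>
    push_cast at hy
    obtain ⟨x, hxN, hyx, hxy⟩ := ih (fun i h1 h2 => hc i h1 (by omega)) (by omega)
    obtain ⟨hl, -, hle⟩ := hc (j + t) (by omega) (by omega)
    rw [← add_assoc]
    rcases hxN.lt_or_eq with h | h
    · refine ⟨x + 1, h, by push_cast; omega, ?_⟩
      have := hle (x + 1)
      have := ht_fill_succ_le (P := c (j + t)) (k := x) (by omega)
      push_cast; omega
    · rcases Nat.eq_zero_or_pos x with rfl | hpos
      · rw [ht_zero] at hxy; omega
      · obtain ⟨z, rfl⟩ : ∃ z, x = z + 1 := ⟨x - 1, by omega⟩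
        refine ⟨z, by omega, by push_cast at *; omega, ?_⟩
        have := hle z
        have := ht_fill_le_succ (P := c (j + t)) (k := z) (by omega)
        push_cast; omega

lemma degree_eq {P : BinPath} {m : ℕ} {y : ℤ} (hm : y + m + 1 = P.length)
    (h : ∀ x ≤ P.length, min (x : ℤ) y ≤ ht P x)
    (hx : ∃ x : ℕ, x ≤ P.length ∧ y < x ∧ ht P x ≤ y) : degree P = m := by
  have hmem : fill^[m] P = maxPath P.length := by
    have h1 := min_le_ht_iterate_fill h m P.length le_rfl
    have hl := length_iterate_fill P m
    have h2 := ht_parity (P := fill^[m] P) (k := P.length) hl.ge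
    rw [← hl]
    apply eq_maxPath
    rw [hl]
    omega
  refine le_antisymm (Nat.sInf_le hmem) ?_
  by_contra! hlt
  have hs : fill^[degree P] P = maxPath P.length :=
    Nat.sInf_mem (s := {k | fill^[k] P = maxPath P.length}) ⟨m, hmem⟩
  obtain ⟨x, hx1, hx2, hx3⟩ := exists_ht_le (c := fun i => fill^[i] P) (j := 0) hx (degree P)
    (fun i _ _ => ⟨length_iterate_fill P i, by
      rw [Function.iterate_succ_apply']; exact ⟨rfl, fun _ => le_rfl⟩⟩) (by omega)
  simp only [zero_add] at hx3
  rw [hs, ht_maxPath hx1] at hx3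
  omega

end Fill

section Insertion

/-- Replace the first `i` steps of `P` by `uⁱd`. -/
def insertDown (i : ℕ) (P : BinPath) : BinPath := List.replicate i true ++ false :: P.drop i

lemma length_insertDown {i : ℕ} {P : BinPath} (hi : i ≤ P.length) :
    (insertDown i P).length = P.length + 1 := by
  simp [insertDown]; omega

lemma ht_insertDown_of_le {i x : ℕ} (P : BinPath) (hx : x ≤ i) : ht (insertDown i P) x = x := by
  rw [insertDown, ht_append, ht_replicate, List.length_replicate, Nat.sub_eq_zero_of_le hx, ht_zero]
  simp [hx]

lemma ht_insertDown_succ {i x : ℕ} {P : BinPath} (h : (i : ℤ) ≤ ht P i) (hx : i ≤ x) :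
    ht (insertDown i P) (x + 1) = ht P x - 1 := by
  obtain ⟨z, rfl⟩ := Nat.exists_eq_add_of_le hx
  rw [insertDown, ht_append, ht_replicate, List.length_replicate,
    show i + z + 1 - i = z + 1 by omega, ht_cons_false, ht_drop, ht_eq_of_le h le_rfl]
  push_cast
  rw [min_eq_right (by omega)]
  ring

lemma fill_insertDown {i : ℕ} {P : BinPath} (hi : i < P.length)
    (h : ((i + 1 : ℕ) : ℤ) ≤ ht P (i + 1)) :
    fill (insertDown i P) = insertDown (i + 1) (fill P) := by
  have hl := length_insertDown hi.le
  have h0 : (i : ℤ) ≤ ht P i := (ht_eq_of_le h (Nat.le_succ i)).ge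
  have hP := fun x (hx : x ≤ i + 1) => ht_eq_of_le h hx
  have hF : ((i + 1 : ℕ) : ℤ) ≤ ht (fill P) (i + 1) := by
    rcases (Nat.succ_le_of_lt hi).lt_or_eq with h' | h'
    · have : ht P (i + 1) - 1 ≤ ht P (i + 2) := le_ht_succ P (i + 1)
      rw [ht_fill h']; push_cast at *; omega
    · rw [ht_fill_last h']; push_cast at *; omega
  refine path_ext ?_ fun x hx => ?_
  · rw [length_fill, hl, length_insertDown (by rw [length_fill]; omega), length_fill]
  rw [length_fill, hl] at hx
  cases x with
  | zero => simp [ht_zero]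
  | succ x =>
    by_cases hxi : x ≤ i
    · rw [ht_insertDown_of_le _ (by omega)]
      have e1 := ht_insertDown_of_le P hxi
      rcases hx.lt_or_eq with hx' | hx'
      · rw [ht_fill (by omega), e1]
        by_cases hxi' : x + 2 ≤ i
        · rw [ht_insertDown_of_le _ hxi']; push_cast; omega
        · rw [ht_insertDown_succ h0 (by omega), hP (x + 1) (by omega)]; push_cast; omega
      · rw [ht_fill_last (by omega), e1]; push_cast; omega
    · obtain ⟨z, rfl⟩ : ∃ z, x = z + 1 := ⟨x - 1, by omega⟩
      rw [ht_insertDown_succ hF (by omega)]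
      rcases hx.lt_or_eq with hx' | hx'
      · rw [ht_fill (by omega), ht_fill (by omega), ht_insertDown_succ h0 (by omega),
          ht_insertDown_succ h0 (by omega)]
        omega
      · rw [ht_fill_last (by omega), ht_fill_last (by omega), ht_insertDown_succ h0 (by omega)]
        omega

lemma insertDown_le_insertDown {i : ℕ} {P Q : BinPath} (hi : i ≤ P.length)
    (hP : (i : ℤ) ≤ ht P i) (hQ : (i : ℤ) ≤ ht Q i) :
    pathLe (insertDown i P) (insertDown i Q) ↔ pathLe P Q := by
  constructor
  · rintro ⟨hl, h⟩
    have hQl : i ≤ Q.length := by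
      by_contra! hlt
      have := ht_of_length_le hlt.le
      have := ht_le Q Q.length
      omega
    rw [length_insertDown hi, length_insertDown hQl] at hl
    refine pathLe_of_forall (by omega) fun k _ => ?_
    by_cases hk : k ≤ i
    · rw [ht_eq_of_le hP hk, ht_eq_of_le hQ hk]
    · have := h (k + 1)
      rw [ht_insertDown_succ hP (by omega), ht_insertDown_succ hQ (by omega)] at this
      omega
  · rintro ⟨hl, h⟩
    refine pathLe_of_forall ?_ fun k _ => ?_
    · rw [length_insertDown hi, length_insertDown (by omega), hl]
    · by_cases hk : k ≤ i
      · rw [ht_insertDown_of_le _ hk, ht_insertDown_of_le _ hk]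
      · obtain ⟨z, rfl⟩ : ∃ z, k = z + 1 := ⟨k - 1, by omega⟩
        rw [ht_insertDown_succ hP (by omega), ht_insertDown_succ hQ (by omega)]
        have := h z
        omega

lemma insertDown_le_insertDown_succ {i : ℕ} {P Q : BinPath} (hl : P.length = Q.length)
    (hi : i < P.length) (hP : (i : ℤ) ≤ ht P i) (hQ : ((i + 1 : ℕ) : ℤ) ≤ ht Q (i + 1)) :
    pathLe (insertDown i P) (insertDown (i + 1) Q) ↔ pathLe P Q := by
  constructor
  · rintro ⟨-, h⟩
    refine pathLe_of_forall hl fun k _ => ?_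
    by_cases hk : k ≤ i + 1
    · rw [ht_eq_of_le hQ hk]; exact ht_le P k
    · have := h (k + 1)
      rw [ht_insertDown_succ hP (by omega), ht_insertDown_succ hQ (by omega)] at this
      omega
  · rintro ⟨-, h⟩
    refine pathLe_of_forall ?_ fun k _ => ?_
    · rw [length_insertDown hi.le, length_insertDown (by omega), hl]
    · by_cases hk : k ≤ i + 1
      · rw [ht_insertDown_of_le _ hk]; exact ht_le _ k
      · obtain ⟨z, rfl⟩ : ∃ z, k = z + 1 := ⟨k - 1, by omega⟩
        rw [ht_insertDown_succ hP (by omega), ht_insertDown_succ hQ (by omega)]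
        have := h z
        omega

lemma insertDown_injective {i : ℕ} {P Q : BinPath} (hi : i ≤ P.length) (hl : P.length = Q.length)
    (hP : (i : ℤ) ≤ ht P i) (hQ : (i : ℤ) ≤ ht Q i) (h : insertDown i P = insertDown i Q) :
    P = Q := by
  have h1 := (insertDown_le_insertDown hi hP hQ).1 (h ▸ ⟨rfl, fun _ => le_rfl⟩)
  have h2 := (insertDown_le_insertDown (by omega) hQ hP).1 (h ▸ ⟨rfl, fun _ => le_rfl⟩)
  exact path_ext hl fun k _ => le_antisymm (h1.2 k) (h2.2 k)

lemma exists_insertDown {i n : ℕ} {A : BinPath} (hl : A.length = n + 1) (hi : i ≤ n)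
    (h0 : (i : ℤ) ≤ ht A i) (h1 : ht A (i + 1) ≤ i - 1) :
    ∃ P : BinPath, P.length = n ∧ (i : ℤ) ≤ ht P i ∧ insertDown i P = A := by
  have hd : A.getD i true = false := by
    have := ht_succ (P := A) (k := i) (by omega)
    by_contra hne
    simp only [Bool.not_eq_false] at hne
    rw [hne] at this
    simp at this
    omega
  refine ⟨List.replicate i true ++ A.drop (i + 1), by simp; omega, ?_, ?_⟩
  · rw [ht_append, ht_replicate]; simp [ht_zero]
  · have hP : (i : ℤ) ≤ ht (List.replicate i true ++ A.drop (i + 1)) i := by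
      rw [ht_append, ht_replicate]; simp [ht_zero]
    have hPl : (List.replicate i true ++ A.drop (i + 1)).length = n := by simp; omega
    refine path_ext (by rw [length_insertDown (by omega)]; omega) fun k _ => ?_
    by_cases hk : k ≤ i
    · rw [ht_insertDown_of_le _ hk, ht_eq_of_le h0 hk]
    · obtain ⟨z, rfl⟩ := Nat.exists_eq_add_of_lt (not_le.1 hk)
      rw [ht_insertDown_succ hP (by omega), ht_append, ht_replicate, List.length_replicate, ht_drop,
        Nat.add_sub_cancel_left, show i + 1 + z = i + z + 1 by omega]
      have := le_ht_succ A i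
      have := ht_eq_of_le h0 le_rfl
      push_cast
      rw [min_eq_right (by omega)]
      omega

end Insertion

section Chains

/-- Going back one step in a chain with small intervals shortens the initial run of upsteps
by at most one. -/
lemma le_ht_of_le_fill {P Q : BinPath} {k : ℕ} (h : pathLe Q (fill P)) (hk : k + 1 ≤ P.length)
    (hQ : ((k + 1 : ℕ) : ℤ) ≤ ht Q (k + 1)) : (k : ℤ) ≤ ht P k := by
  have := h.2 (k + 1)
  have := ht_fill_succ_le hk
  push_cast at hQ
  omega

/-- The chains with small intervals of length `m` from `P` to the maximum path. -/
def smallChains (P : BinPath) (m : ℕ) : Set (ℕ → BinPath) :=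
  {c | c 0 = P ∧ (∀ i, m ≤ i → c i = maxPath P.length) ∧
    ∀ i < m, pathLt (c i) (c (i + 1)) ∧ pathLe (c (i + 1)) (fill (c i))}

lemma fPath_eq_ncard_smallChains {P : BinPath} {m : ℕ} (h : degree P = m) :
    fPath P = (smallChains P m).ncard := by
  rw [fPath, h, smallChains]

lemma length_of_mem_smallChains {P : BinPath} {m : ℕ} {c : ℕ → BinPath}
    (hc : c ∈ smallChains P m) (i : ℕ) : (c i).length = P.length := by
  by_cases hi : m ≤ i
  · rw [hc.2.1 i hi, length_maxPath]
  · induction i with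
    | zero => rw [hc.1]
    | succ i ih => rw [← (hc.2.2 i (by omega)).1.1.1, ih (by omega)]

lemma le_ht_of_mem_smallChains {P : BinPath} {m a i : ℕ} {c : ℕ → BinPath}
    (hc : c ∈ smallChains P m) (ham : m + a = P.length) (hi : i ≤ m) :
    ((i + a : ℕ) : ℤ) ≤ ht (c i) (i + a) := by
  induction hi using Nat.decreasingInduction with
  | self => rw [hc.2.1 m le_rfl, ht_maxPath ham.le]
  | of_succ k hk ih =>
    refine le_ht_of_le_fill (hc.2.2 k hk).2 ?_ ?_
    · rw [length_of_mem_smallChains hc]; omega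
    · rwa [show k + a + 1 = k + 1 + a by omega]

/-- Strictness is automatic in a chain whose length is forced by a low point. -/
lemma mem_smallChains {P : BinPath} {m : ℕ} {y : ℤ} {c : ℕ → BinPath}
    (hm : y + m + 1 = P.length) (hx : ∃ x : ℕ, x ≤ P.length ∧ y < x ∧ ht P x ≤ y)
    (h0 : c 0 = P) (hmax : ∀ i, m ≤ i → c i = maxPath P.length)
    (hle : ∀ i < m, pathLe (c i) (c (i + 1)))
    (hfill : ∀ i < m, pathLe (c (i + 1)) (fill (c i))) : c ∈ smallChains P m := by
  have hl : ∀ i, i ≤ m → (c i).length = P.length := by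
    intro i hi
    induction i with
    | zero => rw [h0]
    | succ i ih => rw [← (hle i hi).1, ih (by omega)]
  refine ⟨h0, hmax, fun i hi => ⟨⟨hle i hi, fun heq => ?_⟩, hfill i hi⟩⟩
  have h1 := exists_ht_le (c := c) (j := 0) (by rwa [h0]) i
    (fun k _ hk => ⟨hl k (by omega), hfill k (by omega)⟩) (by omega)
  rw [zero_add, heq] at h1
  obtain ⟨x, hx1, hx2, hx3⟩ := exists_ht_le (c := c) (j := i + 1) h1 (m - (i + 1))
    (fun k _ hk => ⟨hl k (by omega), hfill k (by omega)⟩) (by omega)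
  rw [Nat.add_sub_cancel' hi, hmax m le_rfl, ht_maxPath hx1] at hx3
  omega

/-- The chain obtained by prepending a downstep to all paths of a chain and letting it move one
step to the right at each stage. -/
def insertDownChain (n : ℕ) (c : ℕ → BinPath) (i : ℕ) : BinPath :=
  if i ≤ n then insertDown i (c i) else maxPath (n + 1)

variable {P : BinPath} {m : ℕ}

lemma le_ht_self_of_mem_smallChains {c : ℕ → BinPath} (hm : m + 1 = P.length)
    (hc : c ∈ smallChains P m) {i : ℕ} (hi : i ≤ m + 1) : (i : ℤ) ≤ ht (c i) i := by
  rcases hi.lt_or_eq with h | rfl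
  · exact (ht_eq_of_le (le_ht_of_mem_smallChains hc hm (by omega)) (Nat.le_succ i)).ge
  · rw [hc.2.1 _ (by omega), ht_maxPath hm.le]

lemma insertDownChain_mem (hm : m + 1 = P.length) {c : ℕ → BinPath} (hc : c ∈ smallChains P m) :
    insertDownChain (m + 1) c ∈ smallChains (false :: P) (m + 2) := by
  have hl := length_of_mem_smallChains hc
  have hht := fun i => le_ht_self_of_mem_smallChains hm hc (i := i)
  have hstep : ∀ i, i ≤ m → pathLe (c i) (c (i + 1)) ∧ pathLe (c (i + 1)) (fill (c i)) := by
    intro i hi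
    rcases hi.lt_or_eq with h | rfl
    · exact ⟨(hc.2.2 i h).1.1, (hc.2.2 i h).2⟩
    · have e := ht_maxPath (le_refl P.length)
      have e' : ht (maxPath P.length) i = i := ht_maxPath (by omega)
      rw [hc.2.1 i le_rfl, hc.2.1 (i + 1) (by omega)]
      refine ⟨⟨rfl, fun _ => le_rfl⟩, pathLe_of_forall (length_fill _).symm fun k hk => ?_⟩
      rw [length_maxPath] at hk
      have hF : (P.length : ℤ) ≤ ht (fill (maxPath P.length)) P.length := by
        rw [← hm, ht_fill_last (by rw [length_maxPath]), hm, e']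
        push_cast [← hm]; omega
      rw [ht_eq_of_le hF hk]
      exact ht_le _ _
  refine mem_smallChains (y := -1) (by simp [← hm]; ring)
    ⟨1, by simp, by simp, by rw [ht_cons_false, ht_zero]; simp⟩ ?_ ?_ ?_ ?_
  · simp [insertDownChain, insertDown, hc.1]
  · intro i hi
    rw [insertDownChain, if_neg (by omega)]
    simp [hm]
  · intro i hi
    rw [insertDownChain, if_pos (by omega), insertDownChain]
    split_ifs with h
    · exact (insertDown_le_insertDown_succ (by rw [hl, hl]) (by rw [hl]; omega) (hht i (by omega))
        (hht (i + 1) h)).2 (hstep i (by omega)).1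
    · have hli : (insertDown i (c i)).length = m + 1 + 1 := by
        rw [length_insertDown (by rw [hl]; omega), hl, hm]
      refine pathLe_of_forall (by rw [hli, length_maxPath]) fun k hk => ?_
      rw [ht_maxPath (by omega)]
      exact ht_le _ _
  · intro i hi
    rw [insertDownChain, insertDownChain, if_pos (show i ≤ m + 1 by omega)]
    split_ifs with h
    · have hs := le_ht_of_mem_smallChains hc hm (i := i) (by omega)
      have hF := (hht (i + 1) h).trans ((hstep i (by omega)).2.2 (i + 1))
      rw [fill_insertDown (by rw [hl]; omega) hs]
      exact (insertDown_le_insertDown (by rw [hl]; omega) (hht (i + 1) h) hF).2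
        (hstep i (by omega)).2
    · obtain rfl : i = m + 1 := by omega
      have hli : (insertDown (m + 1) (c (m + 1))).length = m + 1 + 1 := by
        rw [length_insertDown (by rw [hl]; omega), hl, hm]
      have hF : ((m + 1 + 1 : ℕ) : ℤ) ≤ ht (fill (insertDown (m + 1) (c (m + 1)))) (m + 1 + 1) := by
        rw [ht_fill_last hli.symm, ht_insertDown_of_le _ le_rfl]
        push_cast; omega
      refine pathLe_of_forall (by rw [length_fill, hli, length_maxPath]) fun k hk => ?_
      rw [length_maxPath] at hk
      rw [ht_maxPath hk, ht_eq_of_le hF hk]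

lemma exists_insertDownChain_eq (hm : m + 1 = P.length)
    (hx : ∃ x : ℕ, x ≤ P.length ∧ (0 : ℤ) < x ∧ ht P x ≤ 0)
    {c : ℕ → BinPath} (hc : c ∈ smallChains (false :: P) (m + 2)) :
    ∃ b ∈ smallChains P m, insertDownChain (m + 1) b = c := by
  have hl : ∀ i, (c i).length = m + 1 + 1 := fun i => by
    rw [length_of_mem_smallChains hc, List.length_cons, hm]
  have hup : ∀ i, i ≤ m + 2 → (i : ℤ) ≤ ht (c i) i := fun i hi => by
    simpa using le_ht_of_mem_smallChains hc (a := 0) (by simp [← hm]) hi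
  have hdown : ∀ i, i ≤ m + 1 → ht (c i) (i + 1) ≤ i - 1 := by
    intro i hi
    induction i with
    | zero => rw [hc.1, ht_cons_false, ht_zero]; simp
    | succ i ih =>
      have h1 := ih (by omega)
      have h2 := (hc.2.2 i (by omega)).2.2 (i + 1 + 1)
      have h3 := ht_fill_succ_le (P := c i) (k := i + 1) (by rw [hl]; omega)
      push_cast; omega
  have hex : ∀ i, ∃ Q : BinPath, i ≤ m + 1 →
      Q.length = m + 1 ∧ (i : ℤ) ≤ ht Q i ∧ insertDown i Q = c i := by
    intro i
    by_cases hi : i ≤ m + 1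
    · obtain ⟨Q, hQ⟩ := exists_insertDown (hl i) hi (hup i (by omega)) (hdown i hi)
      exact ⟨Q, fun _ => hQ⟩
    · exact ⟨[], fun h => absurd h hi⟩
  choose q hq using hex
  have hq1 : ∀ i, i ≤ m → ((i + 1 : ℕ) : ℤ) ≤ ht (q i) (i + 1) := by
    intro i hi
    obtain ⟨h1, h2, h3⟩ := hq i (by omega)
    have h4 := (hup (i + 1) (by omega)).trans ((hc.2.2 i (by omega)).2.2 (i + 1))
    have h5 := ht_fill_le_succ (P := c i) (k := i + 1) (by rw [hl]; omega)
    rw [← h3] at h4 h5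
    rw [ht_insertDown_succ h2 (by omega)] at h5
    omega
  have hqm : ∀ i, i = m ∨ i = m + 1 → q i = maxPath P.length := by
    intro i hi
    obtain ⟨h1, h2, -⟩ := hq i (by omega)
    rw [← hm, ← h1]
    apply eq_maxPath
    rw [h1]
    rcases hi with rfl | rfl
    · exact hq1 _ le_rfl
    · exact h2
  let b : ℕ → BinPath := fun i => if i ≤ m + 1 then q i else maxPath P.length
  have hb : ∀ i, i ≤ m + 1 → b i = q i := fun i hi => if_pos hi
  refine ⟨b, mem_smallChains (y := 0) (by rw [← hm]; push_cast; ring) hx ?_ ?_ ?_ ?_, ?_⟩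
  · have h := (hq 0 (by omega)).2.2
    rw [hc.1] at h
    rw [hb 0 (by omega)]
    simpa [insertDown] using h
  · intro i hi
    by_cases h : i ≤ m + 1
    · rw [hb i h, hqm i (by omega)]
    · exact if_neg h
  · intro i hi
    rw [hb i (by omega), hb (i + 1) (by omega)]
    obtain ⟨h1, h2, h3⟩ := hq i (by omega)
    obtain ⟨h1', h2', h3'⟩ := hq (i + 1) (by omega)
    rw [← insertDown_le_insertDown_succ (by omega) (by omega) h2 h2', h3, h3']
    exact (hc.2.2 i (by omega)).1.1
  · intro i hi
    rw [hb i (by omega), hb (i + 1) (by omega)]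
    obtain ⟨h1, h2, h3⟩ := hq i (by omega)
    obtain ⟨h1', h2', h3'⟩ := hq (i + 1) (by omega)
    have hs := hq1 i hi.le
    have hle := (hc.2.2 i (by omega)).2
    rw [← h3, ← h3', fill_insertDown (by omega) hs] at hle
    refine (insertDown_le_insertDown (by omega) h2' ?_).1 hle
    have hs' := hq1 (i + 1) (by omega)
    have e2 : ht (q i) (i + 1) - 1 ≤ ht (q i) (i + 2) := le_ht_succ (q i) (i + 1)
    rw [ht_fill (by omega)]
    push_cast at *; omega
  · funext i
    rw [insertDownChain]
    split_ifs with h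
    · rw [hb i h, (hq i h).2.2]
    · rw [hc.2.1 i (by omega), List.length_cons, hm]

end Chains

/-- If `P` is a Dyck prefix with at least one return point
(a non-initial point at height 0), then `f(dP) = f(P)`. -/
theorem statement12 (P : BinPath) (hP : IsDyckPrefix P)
    (hret : ∃ i : ℕ, 0 < i ∧ i ≤ P.length ∧ ht P i = 0) :
    fPath (false :: P) = fPath P := by
  obtain ⟨r, hr0, hrl, hr⟩ := hret
  obtain ⟨Q, -, hQ⟩ := hP
  have hnonneg : ∀ x ≤ P.length, 0 ≤ ht P x := by
    intro x hx
    have := hQ x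
    rwa [ht_append, Nat.sub_eq_zero_of_le hx, ht_zero, add_zero] at this
  obtain ⟨m, hm⟩ : ∃ m, m + 1 = P.length := ⟨P.length - 1, by omega⟩
  have hx : ∃ x : ℕ, x ≤ P.length ∧ (0 : ℤ) < x ∧ ht P x ≤ 0 := ⟨r, hrl, by omega, hr.le⟩
  have hdeg : degree P = m := by
    refine degree_eq (y := 0) (by rw [← hm]; push_cast; ring) (fun x hx => ?_) hx
    have := hnonneg x hx
    omega
  have hdeg' : degree (false :: P) = m + 2 := by
    refine degree_eq (y := -1) (by simp [← hm]; ring) (fun x hx => ?_)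
      ⟨1, by simp, by simp, by rw [ht_cons_false, ht_zero]; simp⟩
    cases x with
    | zero => simp [ht_zero]
    | succ x =>
      have := hnonneg x (by simpa using hx)
      rw [ht_cons_false]; omega
  rw [fPath_eq_ncard_smallChains hdeg, fPath_eq_ncard_smallChains hdeg']
  symm
  refine Set.ncard_congr (fun c _ => insertDownChain (m + 1) c)
    (fun c hc => insertDownChain_mem hm hc) (fun b c hb hc h => ?_)
    (fun c hc => ?_)
  · funext i
    have hi := congrFun h i
    simp only [insertDownChain] at hi
    by_cases h' : i ≤ m + 1
    · rw [if_pos h', if_pos h'] at hi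
      exact insertDown_injective (by rw [length_of_mem_smallChains hb]; omega)
        (by rw [length_of_mem_smallChains hb, length_of_mem_smallChains hc])
        (le_ht_self_of_mem_smallChains hm hb h') (le_ht_self_of_mem_smallChains hm hc h') hi
    · rw [hb.2.1 i (by omega), hc.2.1 i (by omega)]
  · obtain ⟨b, hb, rfl⟩ := exists_insertDownChain_eq hm hx hc
    exact ⟨b, hb, rfl⟩
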